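/- Let P ∈ V_n^d be an orthogonal polynomial of degree n on B^d with respect to the Lebesgue measure. Then for every t ∈ [-1,1] and every ξ ∈ S^{d-1}, R P(ξ,t) = b_{d-1} (1-t²)^{(d-1)/2} C_n^{d/2}(t) / C_n^{d/2}(1) · P(ξ). In particular this holds when P is a (homogeneous, harmonic) spherical harmonic of degree n. -/

import Mathlib

open MeasureTheory Real Finset Filter Topology RealInnerProductSpace

noncomputable section

/-- `ℝ^d` with the Euclidean structure. -/
abbrev Esp (d : ℕ) := EuclideanSpace ℝ (Fin d)

/-- The Radon transform `R f(ξ, t)`: integral of `f` over the hyperplane `⟨ξ, x⟩ = t`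
intersected with the closed unit ball `B^d` (for `f` supported in `B^d` this is the integral
over the whole hyperplane). -/
def radon {d : ℕ} (f : Esp d → ℝ) (ξ : Esp d) (t : ℝ) : ℝ :=
  ∫ y in {y : ((ℝ ∙ ξ)ᗮ : Submodule ℝ (Esp d)) |
      t • ξ + (y : Esp d) ∈ Metric.closedBall (0 : Esp d) 1},
    f (t • ξ + (y : Esp d))

/-- The surface measure `dω` on the unit sphere `S^{d-1}`. -/
def sphereMeasure (d : ℕ) : Measure (Metric.sphere (0 : Esp d) 1) :=
  (volume : Measure (Esp d)).toSphere

/-- `σ_d = 2 π^{d/2} / Γ(d/2)`, the surface area of `S^{d-1}`. -/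
def sigmaConst (d : ℕ) : ℝ := 2 * Real.pi ^ ((d : ℝ) / 2) / Real.Gamma ((d : ℝ) / 2)

/-- `b_d = π^{d/2} / Γ((d+2)/2)`, the volume of the unit ball `B^d`. -/
def ballVol (d : ℕ) : ℝ := Real.pi ^ ((d : ℝ) / 2) / Real.Gamma (((d : ℝ) + 2) / 2)

/-- `c_λ = Γ(1/2) Γ(λ+1/2) / Γ(λ+1)`, normalization constant of `(1-t²)^{λ-1/2}` on `[-1,1]`. -/
def cConst (lam : ℝ) : ℝ := Real.Gamma (1 / 2) * Real.Gamma (lam + 1 / 2) / Real.Gamma (lam + 1)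

/-- Pochhammer symbol `(a)_k = a (a+1) ⋯ (a+k-1)`. -/
def poch (a : ℝ) (k : ℕ) : ℝ := ∏ i ∈ Finset.range k, (a + i)

/-- The Gegenbauer polynomial `C_n^λ(t)`, normalized by
`c_λ ∫_{-1}^1 C_k^λ C_l^λ (1-t²)^{λ-1/2} dt = (λ (2λ)_k / ((k+λ) k!)) δ_{k,l}`. -/
def gegen (lam : ℝ) (n : ℕ) (t : ℝ) : ℝ :=
  ∑ k ∈ Finset.range (n / 2 + 1),
    (-1 : ℝ) ^ k * Real.Gamma ((n : ℝ) - k + lam) /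
      (Real.Gamma lam * (Nat.factorial k) * (Nat.factorial (n - 2 * k))) * (2 * t) ^ (n - 2 * k)

/-- `h_n^{(λ)} = λ (2λ)_n / ((n+λ) n!)`, the square of the norm of `C_n^λ`. -/
def hGegen (lam : ℝ) (n : ℕ) : ℝ := lam * poch (2 * lam) n / (((n : ℝ) + lam) * n.factorial)

/-- The kernel `Φ_n(t,u) = Σ_{k=0}^n ((k+d/2)/(d/2)) C_k^{d/2}(t) C_k^{d/2}(u)`. -/
def Phi (d n : ℕ) (t u : ℝ) : ℝ :=
  ∑ k ∈ Finset.range (n + 1),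
    (((k : ℝ) + (d : ℝ) / 2) / ((d : ℝ) / 2)) * gegen ((d : ℝ) / 2) k t * gegen ((d : ℝ) / 2) k u

/-- The Jacobi polynomial `P_n^{(a,b)}`. -/
def jacobiP (a b : ℝ) (n : ℕ) (x : ℝ) : ℝ :=
  ∑ s ∈ Finset.range (n + 1),
    (Real.Gamma (a + n + 1) / (Real.Gamma (a + s + 1) * Nat.factorial (n - s))) *
      (Real.Gamma (b + n + 1) / (Real.Gamma (b + (n : ℝ) - s + 1) * Nat.factorial s)) *
      ((x - 1) / 2) ^ s * ((x + 1) / 2) ^ (n - s)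

/-- `h_k^{(a,b)}`, the square of the norm of `P_k^{(a,b)}` for the normalized Jacobi weight. -/
def hJacobi (a b : ℝ) (k : ℕ) : ℝ :=
  poch (a + 1) k * poch (b + 1) k * (a + b + k + 1) /
    (k.factorial * poch (a + b + 2) k * (a + b + 2 * k + 1))

/-- The orthonormal Jacobi polynomial `p_k^{(a,b)} = [h_k^{(a,b)}]^{-1/2} P_k^{(a,b)}`. -/
def jacobiOrtho (a b : ℝ) (k : ℕ) (x : ℝ) : ℝ := jacobiP a b k x / Real.sqrt (hJacobi a b k)

/-- The constant `h_{n,k}` with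
`h_{n,k}² = Γ((d+2)/2) Γ(n-2k+d/2) / (Γ(d/2) Γ(n-2k+(d+2)/2))`. -/
def hnk (d n k : ℕ) : ℝ :=
  Real.sqrt (Real.Gamma (((d : ℝ) + 2) / 2) * Real.Gamma ((n : ℝ) - 2 * k + (d : ℝ) / 2) /
    (Real.Gamma ((d : ℝ) / 2) * Real.Gamma ((n : ℝ) - 2 * k + ((d : ℝ) + 2) / 2)))

/-- The orthonormal basis element
`f_{k,j}^n(x) = h_{n,k}^{-1} p_k^{(0, n-2k+(d-2)/2)}(2‖x‖²-1) Y(x)` of `V_n^d`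
(for the Lebesgue measure, i.e. `μ = 1/2`), built from a spherical harmonic `Y` of
degree `n - 2k`. -/
def fkjBasis (d n k : ℕ) (Y : Esp d → ℝ) (x : Esp d) : ℝ :=
  (hnk d n k)⁻¹ * jacobiOrtho 0 ((n : ℝ) - 2 * k + ((d : ℝ) - 2) / 2) k (2 * ‖x‖ ^ 2 - 1) * Y x

/-- `g_{k,j}^n(ξ,t) = [h_n^{(d/2)}]^{-1/2} (1-t²)^{(d-1)/2} C_n^{d/2}(t) Y(ξ)`,
built from a spherical harmonic `Y` of degree `n - 2k`. -/
def gkjBasis (d n : ℕ) (Y : Esp d → ℝ) (ξ : Esp d) (t : ℝ) : ℝ :=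
  (Real.sqrt (hGegen ((d : ℝ) / 2) n))⁻¹ * (1 - t ^ 2) ^ (((d : ℝ) - 1) / 2) *
    gegen ((d : ℝ) / 2) n t * Y ξ

/-- `P : ℝ^d → ℝ` is (the evaluation of) a polynomial of total degree at most `n`. -/
def IsPolyDeg (d n : ℕ) (P : Esp d → ℝ) : Prop :=
  ∃ p : MvPolynomial (Fin d) ℝ, p.totalDegree ≤ n ∧
    ∀ x : Esp d, P x = MvPolynomial.eval (fun i => x i) p

/-- `P ∈ V_n^d`: `P` is a polynomial of degree at most `n` which is orthogonal, in
`L²(B^d, dx)`, to all polynomials of total degree `< n`. -/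
def MemV (d n : ℕ) (P : Esp d → ℝ) : Prop :=
  IsPolyDeg d n P ∧
    ∀ Q : Esp d → ℝ,
      (∃ q : MvPolynomial (Fin d) ℝ, q.totalDegree < n ∧
          ∀ x : Esp d, Q x = MvPolynomial.eval (fun i => x i) q) →
      ∫ x in Metric.closedBall (0 : Esp d) 1, P x * Q x = 0

/-- `p = proj_n f`, the orthogonal projection of `f` onto `V_n^d` in
`L²(B^d, b_d^{-1} dx)`: `p ∈ V_n^d` and `f - p ⟂ V_n^d`. -/
def IsProjOn (d n : ℕ) (f p : Esp d → ℝ) : Prop :=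
  MemV d n p ∧ ∀ Q : Esp d → ℝ, MemV d n Q →
    ∫ x in Metric.closedBall (0 : Esp d) 1, (f x - p x) * Q x = 0

/-- `P` is harmonic: its Laplacian vanishes identically. -/
def IsHarmonicFn {d : ℕ} (P : Esp d → ℝ) : Prop :=
  ∀ x : Esp d, ∑ i : Fin d,
    iteratedFDeriv ℝ 2 P x ![EuclideanSpace.single i 1, EuclideanSpace.single i 1] = 0

/-- `P` is homogeneous of degree `m`. -/
def IsHomogeneousDeg {d : ℕ} (m : ℕ) (P : Esp d → ℝ) : Prop :=
  ∀ (c : ℝ) (x : Esp d), P (c • x) = c ^ m * P x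

/-- `Y` is a (solid) spherical harmonic of degree `m`: a harmonic homogeneous
polynomial of degree `m`. -/
def IsSphHarm (d m : ℕ) (Y : Esp d → ℝ) : Prop :=
  IsPolyDeg d m Y ∧ IsHomogeneousDeg m Y ∧ IsHarmonicFn Y

/-- The inner product of `L²(Z, w^{1-d})`, `Z = S^{d-1} × [-1,1]`:
`⟨F,G⟩ = c_{d/2} ∫_{-1}^1 σ_d^{-1} ∫_{S^{d-1}} F(ξ,t) G(ξ,t) dω(ξ) (1-t²)^{(1-d)/2} dt`. -/
def innerZ (d : ℕ) (F G : Esp d → ℝ → ℝ) : ℝ :=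
  cConst ((d : ℝ) / 2) * ∫ t in (-1 : ℝ)..1,
    ((sigmaConst d)⁻¹ * ∫ ξ : Metric.sphere (0 : Esp d) 1, F ξ t * G ξ t ∂(sphereMeasure d)) *
      (1 - t ^ 2) ^ ((1 - (d : ℝ)) / 2)

/-- The inner product of `L²(B^d, b_d^{-1} dx)`. -/
def innerB (d : ℕ) (f g : Esp d → ℝ) : ℝ :=
  (ballVol d)⁻¹ * ∫ x in Metric.closedBall (0 : Esp d) 1, f x * g x

/-- The singular values `γ_n = b_{d-1} √(n!/(d)_n)` of the Radon transform. -/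
def svGamma (d n : ℕ) : ℝ := ballVol (d - 1) * Real.sqrt (n.factorial / poch (d : ℝ) n)


/-- The Chebyshev polynomial of the second kind `U_k`. -/
def chebU (k : ℕ) (t : ℝ) : ℝ := (Polynomial.Chebyshev.U ℝ (k : ℤ)).eval t

/-- The kernel `Φ_n(t,u) = Σ_{k=0}^n (k+1) U_k(t) U_k(u)` (the case `d = 2` of `Φ_n`). -/
def PhiU (n : ℕ) (t u : ℝ) : ℝ :=
  ∑ k ∈ Finset.range (n + 1), ((k : ℝ) + 1) * chebU k t * chebU k u

/-- The point `(cos θ, sin θ)` on the unit circle `S¹ ⊆ ℝ²`. -/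
def circlePt (θ : ℝ) : Esp 2 := (WithLp.equiv 2 (Fin 2 → ℝ)).symm ![Real.cos θ, Real.sin θ]

end

open Polynomial in
/-- The differential operator `(1 - X²) D² - a X D` of the Gegenbauer equation. -/
noncomputable def gegenOp (a : ℝ) (p : ℝ[X]) : ℝ[X] :=
  (1 - X ^ 2) * derivative (derivative p) - C a * X * derivative p

section GegenbauerEquation

open Polynomial

theorem coeff_gegenOp (a : ℝ) (p : ℝ[X]) (k : ℕ) :
    (gegenOp a p).coeff k =
      ((k : ℝ) + 2) * (k + 1) * p.coeff (k + 2) - (k * (k - 1) + a * k) * p.coeff k := by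
  rcases k with _ | _ | k
  · simp [gegenOp, sub_mul, mul_assoc, coeff_derivative]
    ring
  · simp [gegenOp, sub_mul, mul_assoc, coeff_X_pow_mul', coeff_derivative]
    ring
  · simp [gegenOp, sub_mul, mul_assoc, coeff_X_pow_mul', coeff_derivative]
    ring

theorem degree_gegenOp_add_lt (a : ℝ) {n : ℕ} {p : ℝ[X]} (hp : p.natDegree ≤ n) :
    (gegenOp a p + C ((n : ℝ) * (n - 1) + a * n) * p).degree < n := by
  rw [degree_lt_iff_coeff_zero]
  intro k hk
  rw [coeff_add, coeff_gegenOp, coeff_C_mul, coeff_eq_zero_of_natDegree_lt (n := k + 2) (by omega)]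
  rcases hk.eq_or_lt with rfl | hk
  · ring
  · rw [coeff_eq_zero_of_natDegree_lt (n := k) (by omega)]
    ring

theorem degree_gegenOp_lt (a : ℝ) {n : ℕ} {p : ℝ[X]} (hp : p.degree < n) :
    (gegenOp a p).degree < n := by
  rw [degree_lt_iff_coeff_zero] at hp ⊢
  intro k hk
  rw [coeff_gegenOp, hp k hk, hp (k + 2) (by omega)]
  ring

/-- A polynomial solution of the Gegenbauer equation is determined by its value at `1`. -/
theorem eq_zero_of_gegenOp_add_eq_zero {a c : ℝ} (ha : 0 < a) {p : ℝ[X]}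
    (hp : gegenOp a p + C c * p = 0) (h1 : p.eval 1 = 0) : p = 0 := by
  induction hn : p.natDegree generalizing a c p with
  | zero =>
    rw [eq_C_of_natDegree_eq_zero hn] at h1 ⊢
    simpa using h1
  | succ n ih =>
    have hd : derivative p = 0 := by
      refine ih (a := a + 2) (c := c - a) (by linarith) ?_ ?_ ?_
      · have h := congrArg derivative hp
        simp only [gegenOp, derivative_add, derivative_sub, derivative_mul, derivative_C,
          derivative_X, derivative_one, derivative_zero, derivative_pow] at h
        rw [← h]
        simp [gegenOp]
        ring
      · have h := congrArg (eval 1) hp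
        simp [gegenOp, h1] at h
        exact h.resolve_left ha.ne'
      · rw [natDegree_derivative, hn, Nat.add_sub_cancel]
    rw [derivative_eq_zero.1 hd] at hn
    omega

theorem hasDerivAt_one_sub_sq_rpow (r : ℝ) {t : ℝ} (ht : t ∈ Set.Ioo (-1 : ℝ) 1) :
    HasDerivAt (fun t : ℝ => (1 - t ^ 2) ^ (r + 1)) (-(2 * (r + 1)) * t * (1 - t ^ 2) ^ r) t := by
  have hpos : (0 : ℝ) < 1 - t ^ 2 := by nlinarith [ht.1, ht.2]
  have h := ((hasDerivAt_pow 2 t).const_sub 1).rpow_const (p := r + 1) (Or.inl hpos.ne')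
  refine h.congr_deriv ?_
  rw [add_sub_cancel_right]
  push_cast
  ring

theorem continuous_one_sub_sq_rpow {r : ℝ} (hr : 0 ≤ r) :
    Continuous fun t : ℝ => (1 - t ^ 2) ^ r :=
  (by fun_prop : Continuous fun t : ℝ => 1 - t ^ 2).rpow_const fun _ => Or.inr hr

/-- The Gegenbauer operator is symmetric for the weight `(1 - t²)^r`. -/
theorem integral_gegenOp_mul_comm {r : ℝ} (hr : 0 ≤ r) (p q : ℝ[X]) :
    ∫ t in (-1 : ℝ)..1, (1 - t ^ 2) ^ r * ((gegenOp (2 * (r + 1)) p).eval t * q.eval t) =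
      ∫ t in (-1 : ℝ)..1, (1 - t ^ 2) ^ r * (p.eval t * (gegenOp (2 * (r + 1)) q).eval t) := by
  have hw := continuous_one_sub_sq_rpow hr
  have hw' := continuous_one_sub_sq_rpow (r := r + 1) (by linarith)
  rw [← sub_eq_zero, ← intervalIntegral.integral_sub
    (Continuous.intervalIntegrable (by fun_prop) _ _)
    (Continuous.intervalIntegrable (by fun_prop) _ _)]
  rw [intervalIntegral.integral_eq_sub_of_hasDerivAt_of_le (by norm_num)
    (f := fun t => (1 - t ^ 2) ^ (r + 1) *
      ((derivative p).eval t * q.eval t - p.eval t * (derivative q).eval t))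
    (by fun_prop) _ (Continuous.intervalIntegrable (by fun_prop) _ _)]
  · have h0 : (0 : ℝ) ^ (r + 1) = 0 := Real.zero_rpow (by linarith)
    norm_num [h0]
  · intro t ht
    have hpos : (0 : ℝ) < 1 - t ^ 2 := by nlinarith [ht.1, ht.2]
    refine ((hasDerivAt_one_sub_sq_rpow r ht).mul
      ((((derivative p).hasDerivAt t).mul (q.hasDerivAt t)).sub
        ((p.hasDerivAt t).mul ((derivative q).hasDerivAt t)))).congr_deriv ?_
    rw [Real.rpow_add_one hpos.ne']
    simp [gegenOp]
    ring

theorem eq_zero_of_integral_weight_sq_eq_zero {r : ℝ} (hr : 0 ≤ r) (p : ℝ[X])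
    (h : ∫ t in (-1 : ℝ)..1, (1 - t ^ 2) ^ r * (p.eval t * p.eval t) = 0) : p = 0 := by
  have hw := continuous_one_sub_sq_rpow hr
  have hz : ∀ t ∈ Set.Ioo (-1 : ℝ) 1, p.IsRoot t := by
    intro t ht
    by_contra hne
    have hpos : (0 : ℝ) < 1 - t ^ 2 := by nlinarith [ht.1, ht.2]
    refine (intervalIntegral.integral_pos (by norm_num) (by fun_prop) ?_
      ⟨t, Set.Ioo_subset_Icc_self ht, ?_⟩).ne' h
    · intro x hx
      have : (0 : ℝ) ≤ 1 - x ^ 2 := by nlinarith [hx.1, hx.2]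
      exact mul_nonneg (Real.rpow_nonneg this _) (mul_self_nonneg _)
    · exact mul_pos (Real.rpow_pos_of_pos hpos _) (mul_self_pos.2 hne)
  exact eq_zero_of_infinite_isRoot p ((Set.Ioo_infinite (by norm_num)).mono hz)

/-- A polynomial of degree at most `n` which is orthogonal to lower degrees for the weight
`(1 - t²)^r` solves the Gegenbauer equation. -/
theorem gegenOp_add_eq_zero_of_orthogonal {r : ℝ} (hr : 0 ≤ r) {n : ℕ} {p : ℝ[X]}
    (hp : p.natDegree ≤ n)
    (horth : ∀ q : ℝ[X], q.degree < n →
      ∫ t in (-1 : ℝ)..1, (1 - t ^ 2) ^ r * (p.eval t * q.eval t) = 0) :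
    gegenOp (2 * (r + 1)) p + C ((n : ℝ) * (n - 1) + 2 * (r + 1) * n) * p = 0 := by
  have hw := continuous_one_sub_sq_rpow hr
  have hdeg := degree_gegenOp_add_lt (2 * (r + 1)) hp
  set c : ℝ := (n : ℝ) * (n - 1) + 2 * (r + 1) * n
  set s := gegenOp (2 * (r + 1)) p + C c * p with hs
  apply eq_zero_of_integral_weight_sq_eq_zero hr
  have hsplit : ∀ t : ℝ, (1 - t ^ 2) ^ r * (s.eval t * s.eval t) =
      (1 - t ^ 2) ^ r * ((gegenOp (2 * (r + 1)) p).eval t * s.eval t) +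
        c * ((1 - t ^ 2) ^ r * (p.eval t * s.eval t)) := by
    intro t
    have : s.eval t = (gegenOp (2 * (r + 1)) p).eval t + c * p.eval t := by simp [hs]
    nth_rewrite 1 [this]
    ring
  simp only [hsplit]
  rw [intervalIntegral.integral_add (Continuous.intervalIntegrable (by fun_prop) _ _)
    (Continuous.intervalIntegrable (by fun_prop) _ _), intervalIntegral.integral_const_mul,
    integral_gegenOp_mul_comm hr, horth _ (degree_gegenOp_lt _ hdeg), horth _ hdeg]
  simp

/-- The coefficient of `X ^ (n - 2 * k)` in the Gegenbauer polynomial. -/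
noncomputable def gegenCoeff (lam : ℝ) (n k : ℕ) : ℝ :=
  (-1 : ℝ) ^ k * Real.Gamma ((n : ℝ) - k + lam) /
    (Real.Gamma lam * (Nat.factorial k) * (Nat.factorial (n - 2 * k))) * 2 ^ (n - 2 * k)

/-- The Gegenbauer polynomial as a formal polynomial. -/
noncomputable def gegenPoly (lam : ℝ) (n : ℕ) : ℝ[X] :=
  ∑ k ∈ Finset.range (n / 2 + 1), C (gegenCoeff lam n k) * X ^ (n - 2 * k)

theorem eval_gegenPoly (lam : ℝ) (n : ℕ) (t : ℝ) : (gegenPoly lam n).eval t = gegen lam n t := by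
  simp only [gegenPoly, gegen, gegenCoeff, eval_finsetSum, eval_mul, eval_C, eval_pow, eval_X,
    mul_pow, mul_assoc]

theorem gegenPoly_ne_zero {lam : ℝ} (hlam : 0 < lam) (n : ℕ) : gegenPoly lam n ≠ 0 := by
  intro h
  have hc : (gegenPoly lam n).coeff n = gegenCoeff lam n 0 := by
    rw [gegenPoly, finsetSum_coeff, Finset.sum_eq_single 0]
    · simp
    · intro k hk hk0
      rw [Finset.mem_range] at hk
      rw [coeff_C_mul_X_pow, if_neg (by omega)]
    · simp
  have hpos : 0 < gegenCoeff lam n 0 := by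
    have h1 := Real.Gamma_pos_of_pos hlam
    have h2 : 0 < Real.Gamma ((n : ℝ) - (0 : ℕ) + lam) :=
      Real.Gamma_pos_of_pos (by simpa using by positivity)
    unfold gegenCoeff
    positivity
  rw [h, coeff_zero] at hc
  exact hpos.ne hc

theorem gegenCoeff_succ {lam : ℝ} (hlam : 0 < lam) {n k : ℕ} (hk : 2 * (k + 1) ≤ n) :
    4 * ((k : ℝ) + 1) * (n - (k + 1) + lam) * gegenCoeff lam n (k + 1) =
      -(((n - 2 * k : ℕ) : ℝ) * ((n - 2 * k - 1 : ℕ) : ℝ)) * gegenCoeff lam n k := by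
  obtain ⟨m, rfl⟩ := Nat.exists_eq_add_of_le hk
  have e1 : 2 * (k + 1) + m - 2 * k = m + 1 + 1 := by omega
  have e2 : 2 * (k + 1) + m - 2 * (k + 1) = m := by omega
  have hG : Real.Gamma (((2 * (k + 1) + m : ℕ) : ℝ) - k + lam) =
      (((2 * (k + 1) + m : ℕ) : ℝ) - (k + 1) + lam) *
        Real.Gamma (((2 * (k + 1) + m : ℕ) : ℝ) - (k + 1 : ℕ) + lam) := by
    rw [← Nat.cast_add_one k, ← Real.Gamma_add_one]
    · congr 1
      push_cast
      ring
    · push_cast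
      have : (0 : ℝ) < 2 * (k + 1) + m - (k + 1) + lam := by
        have : (0 : ℝ) ≤ k := by positivity
        have : (0 : ℝ) ≤ m := by positivity
        linarith
      exact this.ne'
  have h1 := (Real.Gamma_pos_of_pos hlam).ne'
  unfold gegenCoeff
  rw [hG, e1, e2, Nat.factorial_succ (m + 1), Nat.factorial_succ m, Nat.factorial_succ k]
  have h2 : (m.factorial : ℝ) ≠ 0 := by positivity
  have h3 : (k.factorial : ℝ) ≠ 0 := by positivity
  simp only [Nat.add_sub_cancel]
  push_cast
  field_simp
  ring

theorem gegenOp_C_mul_X_pow (a b : ℝ) (m : ℕ) :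
    gegenOp a (C b * X ^ m) = C (b * (m * (m - 1 : ℕ))) * X ^ (m - 2) -
      C (b * ((m : ℝ) * (m - 1) + a * m)) * X ^ m := by
  rcases m with _ | _ | m
  · simp [gegenOp]
  · simp [gegenOp]
    ring
  · simp [gegenOp]
    ring

theorem gegenOp_add_gegenPoly {lam : ℝ} (hlam : 0 < lam) (n : ℕ) :
    gegenOp (2 * lam + 1) (gegenPoly lam n) +
      C ((n : ℝ) * (n - 1) + (2 * lam + 1) * n) * gegenPoly lam n = 0 := by
  set c : ℝ := (n : ℝ) * (n - 1) + (2 * lam + 1) * n with hc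
  have hpart : ∀ j : ℕ, 2 * j ≤ n →
      ∑ k ∈ Finset.range (j + 1), (gegenOp (2 * lam + 1) (C (gegenCoeff lam n k) * X ^ (n - 2 * k))
        + C c * (C (gegenCoeff lam n k) * X ^ (n - 2 * k))) =
      C (gegenCoeff lam n j * ((n - 2 * j : ℕ) * (n - 2 * j - 1 : ℕ))) * X ^ (n - 2 * j - 2) := by
    intro j
    induction j with
    | zero =>
      intro _
      simp [gegenOp_C_mul_X_pow, hc]
      ring
    | succ j ih =>
      intro hj
      rw [Finset.sum_range_succ, ih (by omega), gegenOp_C_mul_X_pow,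
        show n - 2 * j - 2 = n - 2 * (j + 1) by omega]
      have hrec := gegenCoeff_succ hlam hj
      have hcast : ((n - 2 * (j + 1) : ℕ) : ℝ) = n - 2 * (j + 1) := by
        rw [Nat.cast_sub hj]
        push_cast
        ring
      have key : gegenCoeff lam n j * ((n - 2 * j : ℕ) * (n - 2 * j - 1 : ℕ))
          - gegenCoeff lam n (j + 1) * (((n - 2 * (j + 1) : ℕ) : ℝ) *
            (((n - 2 * (j + 1) : ℕ) : ℝ) - 1) + (2 * lam + 1) * ((n - 2 * (j + 1) : ℕ) : ℝ))
          + c * gegenCoeff lam n (j + 1) = 0 := by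
        rw [hcast, hc]
        linear_combination hrec
      have key' := congrArg (fun x : ℝ => (C x : ℝ[X]) * X ^ (n - 2 * (j + 1))) key
      rw [C_add, C_sub, C_mul (a := c), C_0] at key'
      linear_combination key'
  have hlin : gegenOp (2 * lam + 1) (gegenPoly lam n) + C c * gegenPoly lam n =
      ∑ k ∈ Finset.range (n / 2 + 1),
        (gegenOp (2 * lam + 1) (C (gegenCoeff lam n k) * X ^ (n - 2 * k))
        + C c * (C (gegenCoeff lam n k) * X ^ (n - 2 * k))) := by
    simp only [gegenOp, gegenPoly, derivative_sum, Finset.mul_sum, Finset.sum_add_distrib,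
      Finset.sum_sub_distrib]
  rw [hlin, hpart (n / 2) (by omega)]
  have : n - 2 * (n / 2) = 0 ∨ n - 2 * (n / 2) - 1 = 0 := by omega
  rcases this with h | h <;> simp [h]

/-- A polynomial of degree at most `n` which is orthogonal to lower degrees for the weight
`(1 - t²)^(λ - 1/2)` is a multiple of the Gegenbauer polynomial `C_n^λ`. -/
theorem eval_eq_gegen_div_mul_of_orthogonal {lam : ℝ} (hlam : 1 / 2 ≤ lam) {n : ℕ} {p : ℝ[X]}
    (hp : p.natDegree ≤ n)
    (horth : ∀ q : ℝ[X], q.degree < n →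
      ∫ t in (-1 : ℝ)..1, (1 - t ^ 2) ^ (lam - 1 / 2) * (p.eval t * q.eval t) = 0) (t : ℝ) :
    p.eval t = gegen lam n t / gegen lam n 1 * p.eval 1 := by
  have hp0 := gegenOp_add_eq_zero_of_orthogonal (by linarith) hp horth
  rw [show 2 * (lam - 1 / 2 + 1) = 2 * lam + 1 by ring] at hp0
  have hg0 := gegenOp_add_gegenPoly (lam := lam) (by linarith) n
  have hne : gegen lam n 1 ≠ 0 := fun h => gegenPoly_ne_zero (by linarith) n
    (eq_zero_of_gegenOp_add_eq_zero (by linarith) hg0 (by rw [eval_gegenPoly, h]))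
  have hdiff : C (gegen lam n 1) * p - C (p.eval 1) * gegenPoly lam n = 0 := by
    refine eq_zero_of_gegenOp_add_eq_zero (a := 2 * lam + 1)
      (c := (n : ℝ) * (n - 1) + (2 * lam + 1) * n) (by linarith) ?_ ?_
    · have hlin : gegenOp (2 * lam + 1) (C (gegen lam n 1) * p - C (p.eval 1) * gegenPoly lam n) =
          C (gegen lam n 1) * gegenOp (2 * lam + 1) p -
            C (p.eval 1) * gegenOp (2 * lam + 1) (gegenPoly lam n) := by
        simp [gegenOp]
        ring
      rw [hlin]
      linear_combination C (gegen lam n 1) * hp0 - C (p.eval 1) * hg0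
    · simp [eval_gegenPoly]
      ring
  have h := congrArg (eval t) hdiff
  simp only [eval_sub, eval_mul, eval_C, eval_gegenPoly, eval_zero] at h
  field_simp
  linarith

end GegenbauerEquation

section EvenOddSplit

open MvPolynomial

variable {σ : Type*}

/-- On the unit circle `t² + s² = 1`, the function `f t s z` has the form `A(t, z) + s B(t, z)` with
`A` and `B` polynomials of degree at most `n` and less than `n` in `t`. -/
def IsEvenOddSplit (n : ℕ) (f : ℝ → ℝ → (σ → ℝ) → ℝ) : Prop :=
  ∃ A B : Polynomial (MvPolynomial σ ℝ), A.degree < (n + 1 : ℕ) ∧ B.degree < n ∧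
    ∀ t s z, t ^ 2 + s ^ 2 = 1 → f t s z = A.eval₂ (eval z) t + s * B.eval₂ (eval z) t

theorem IsEvenOddSplit.mono {m n : ℕ} (h : m ≤ n) {f : ℝ → ℝ → (σ → ℝ) → ℝ}
    (hf : IsEvenOddSplit m f) : IsEvenOddSplit n f := by
  obtain ⟨A, B, hA, hB, hf⟩ := hf
  exact ⟨A, B, hA.trans_le (by exact_mod_cast Nat.succ_le_succ h),
    hB.trans_le (by exact_mod_cast h), hf⟩

theorem isEvenOddSplit_const (c : ℝ) :
    IsEvenOddSplit 0 (fun _ _ _ => c : ℝ → ℝ → (σ → ℝ) → ℝ) :=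
  ⟨Polynomial.C (C c), 0, Polynomial.degree_C_lt, by simp, by simp⟩

theorem isEvenOddSplit_linear (c : ℝ) (i : σ) :
    IsEvenOddSplit 1 (fun t s z => t * c + s * z i : ℝ → ℝ → (σ → ℝ) → ℝ) := by
  refine ⟨Polynomial.C (C c) * Polynomial.X, Polynomial.C (X i), ?_, Polynomial.degree_C_lt, ?_⟩
  · exact (Polynomial.degree_C_mul_X_le _).trans_lt (by norm_num)
  · intro t s z _
    simp
    ring

theorem IsEvenOddSplit.add {n : ℕ} {f g : ℝ → ℝ → (σ → ℝ) → ℝ}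
    (hf : IsEvenOddSplit n f) (hg : IsEvenOddSplit n g) :
    IsEvenOddSplit n (fun t s z => f t s z + g t s z) := by
  obtain ⟨A, B, hA, hB, hf⟩ := hf
  obtain ⟨A', B', hA', hB', hg⟩ := hg
  refine ⟨A + A', B + B', (Polynomial.degree_add_le _ _).trans_lt (max_lt hA hA'),
    (Polynomial.degree_add_le _ _).trans_lt (max_lt hB hB'), fun t s z h => ?_⟩
  simp only [hf t s z h, hg t s z h]
  rw [Polynomial.eval₂_add, Polynomial.eval₂_add]
  ring

theorem Polynomial.degree_mul_lt_of_lt {R : Type*} [CommRing R] {p q : Polynomial R} {a b c : ℕ}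
    (hp : p.degree < a) (hq : q.degree < b) (hc : a + b ≤ c + 1) : (p * q).degree < c := by
  rw [Polynomial.degree_lt_iff_coeff_zero] at *
  intro k hk
  rw [Polynomial.coeff_mul]
  refine Finset.sum_eq_zero fun x hx => ?_
  rw [Finset.HasAntidiagonal.mem_antidiagonal] at hx
  rcases le_or_gt a x.1 with h | h
  · rw [hp _ h, zero_mul]
  · rw [hq _ (by omega), mul_zero]

theorem IsEvenOddSplit.mul {m n : ℕ} {f g : ℝ → ℝ → (σ → ℝ) → ℝ}
    (hf : IsEvenOddSplit m f) (hg : IsEvenOddSplit n g) :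
    IsEvenOddSplit (m + n) (fun t s z => f t s z * g t s z) := by
  obtain ⟨A, B, hA, hB, hf⟩ := hf
  obtain ⟨A', B', hA', hB', hg⟩ := hg
  have hBB : (B * B' * (1 - Polynomial.X ^ 2)).degree < ((m + n + 1 : ℕ) : WithBot ℕ) := by
    rcases Nat.eq_zero_or_pos m with rfl | hm
    · rw [Nat.cast_zero, Nat.WithBot.lt_zero_iff, Polynomial.degree_eq_bot] at hB
      simp [hB]
    rcases Nat.eq_zero_or_pos n with rfl | hn
    · rw [Nat.cast_zero, Nat.WithBot.lt_zero_iff, Polynomial.degree_eq_bot] at hB'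
      simp [hB']
    refine Polynomial.degree_mul_lt_of_lt (a := m + n - 1) (b := 3)
      (Polynomial.degree_mul_lt_of_lt hB hB' (c := m + n - 1) (by omega)) ?_ (by omega)
    refine (Polynomial.degree_sub_le _ _).trans_lt (max_lt ?_ ?_)
    · exact Polynomial.degree_one_le.trans_lt (by norm_num)
    · exact (Polynomial.degree_X_pow_le 2).trans_lt (by norm_num)
  refine ⟨A * A' + B * B' * (1 - Polynomial.X ^ 2), A * B' + B * A',
    (Polynomial.degree_add_le _ _).trans_lt (max_lt ?_ hBB),
    (Polynomial.degree_add_le _ _).trans_lt (max_lt ?_ ?_), fun t s z h => ?_⟩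
  · exact Polynomial.degree_mul_lt_of_lt hA hA' (by omega)
  · exact Polynomial.degree_mul_lt_of_lt hA hB' (by omega)
  · exact Polynomial.degree_mul_lt_of_lt hB hA' (by omega)
  · simp only [hf t s z h, hg t s z h, Polynomial.eval₂_add, Polynomial.eval₂_mul,
      Polynomial.eval₂_sub, Polynomial.eval₂_one, Polynomial.eval₂_X_pow]
    linear_combination (B.eval₂ (eval z) t * B'.eval₂ (eval z) t) * h

theorem IsEvenOddSplit.pow {n : ℕ} {f : ℝ → ℝ → (σ → ℝ) → ℝ} (hf : IsEvenOddSplit n f) (k : ℕ) :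
    IsEvenOddSplit (k * n) (fun t s z => f t s z ^ k) := by
  induction k with
  | zero => simpa using isEvenOddSplit_const (σ := σ) 1
  | succ k ih => simpa only [pow_succ, Nat.succ_mul] using ih.mul hf

theorem isEvenOddSplit_prod {ι : Type*} (S : Finset ι) (n : ι → ℕ) (f : ι → ℝ → ℝ → (σ → ℝ) → ℝ)
    (hf : ∀ i ∈ S, IsEvenOddSplit (n i) (f i)) :
    IsEvenOddSplit (∑ i ∈ S, n i) (fun t s z => ∏ i ∈ S, f i t s z) := by
  classical
  induction S using Finset.induction_on with
  | empty => simpa using isEvenOddSplit_const (σ := σ) 1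
  | insert i S hi ih =>
    simp only [Finset.prod_insert hi, Finset.sum_insert hi]
    exact (hf i (Finset.mem_insert_self _ _)).mul
      (ih fun j hj => hf j (Finset.mem_insert_of_mem hj))

theorem isEvenOddSplit_sum {ι : Type*} (S : Finset ι) (n : ℕ) (f : ι → ℝ → ℝ → (σ → ℝ) → ℝ)
    (hf : ∀ i ∈ S, IsEvenOddSplit n (f i)) :
    IsEvenOddSplit n (fun t s z => ∑ i ∈ S, f i t s z) := by
  classical
  induction S using Finset.induction_on with
  | empty => simpa using (isEvenOddSplit_const (σ := σ) 0).mono (Nat.zero_le n)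
  | insert i S hi ih =>
    simp only [Finset.sum_insert hi]
    exact (hf i (Finset.mem_insert_self _ _)).add
      (ih fun j hj => hf j (Finset.mem_insert_of_mem hj))

theorem isEvenOddSplit_eval [Fintype σ] {n : ℕ} {p : MvPolynomial σ ℝ} (hp : p.totalDegree ≤ n)
    (u : σ → ℝ) : IsEvenOddSplit n (fun t s z => eval (fun i => t * u i + s * z i) p) := by
  simp only [eval_eq']
  refine isEvenOddSplit_sum _ _ _ fun m hm => ?_
  have hdeg : ∑ i, m i * 1 ≤ n := by
    refine le_trans ?_ ((le_totalDegree hm).trans hp)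
    simp [Finsupp.sum_fintype]
  exact (((isEvenOddSplit_const (coeff m p)).mul (isEvenOddSplit_prod _ _ _ fun i _ =>
    (isEvenOddSplit_linear (u i) i).pow (m i))).mono (by simpa using hdeg))

end EvenOddSplit

section SlicingByHyperplanes

variable {E : Type*} [NormedAddCommGroup E] [InnerProductSpace ℝ E]

theorem norm_smul_add_orthogonal_sq {ξ : E} (hξ : ‖ξ‖ = 1) (t : ℝ)
    (y : ((ℝ ∙ ξ)ᗮ : Submodule ℝ E)) : ‖t • ξ + (y : E)‖ ^ 2 = t ^ 2 + ‖y‖ ^ 2 := by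
  have h0 : inner ℝ (t • ξ) (y : E) = 0 := by
    rw [inner_smul_left, Submodule.mem_orthogonal_singleton_iff_inner_right.1 y.2, mul_zero]
  rw [pow_two, norm_add_sq_eq_norm_sq_add_norm_sq_of_inner_eq_zero _ _ h0, norm_smul, hξ]
  simp [pow_two]

theorem inner_smul_add_orthogonal {ξ : E} (hξ : ‖ξ‖ = 1) (t : ℝ)
    (y : ((ℝ ∙ ξ)ᗮ : Submodule ℝ E)) : inner ℝ ξ (t • ξ + (y : E)) = t := by
  rw [inner_add_right, inner_smul_right, Submodule.mem_orthogonal_singleton_iff_inner_right.1 y.2,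
    real_inner_self_eq_norm_sq, hξ]
  simp

variable [FiniteDimensional ℝ E] [MeasurableSpace E] [BorelSpace E]

/-- Fubini's theorem for the slices of a Euclidean space by the hyperplanes orthogonal to `ξ`. -/
theorem integral_eq_integral_integral_orthogonal {ξ : E} (hξ : ‖ξ‖ = 1) {f : E → ℝ}
    (hf : Integrable f) :
    ∫ x, f x = ∫ t : ℝ, ∫ y : ((ℝ ∙ ξ)ᗮ : Submodule ℝ E), f (t • ξ + (y : E)) := by
  let e : WithLp 2 (ℝ × ((ℝ ∙ ξ)ᗮ : Submodule ℝ E)) ≃ₗᵢ[ℝ] E :=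
    (LinearIsometryEquiv.withLpProdCongr 2 (LinearIsometryEquiv.toSpanUnitSingleton ξ hξ)
      (LinearIsometryEquiv.refl ℝ _)).trans (ℝ ∙ ξ).orthogonalDecomposition.symm
  let φ : ℝ × ((ℝ ∙ ξ)ᗮ : Submodule ℝ E) ≃ᵐ E :=
    (MeasurableEquiv.toLp 2 _).trans e.toMeasurableEquiv
  have hφ : MeasurePreserving φ :=
    (WithLp.volume_preserving_toLp ℝ ((ℝ ∙ ξ)ᗮ : Submodule ℝ E)).trans e.measurePreserving
  have happ : ∀ p : ℝ × ((ℝ ∙ ξ)ᗮ : Submodule ℝ E), φ p = p.1 • ξ + (p.2 : E) := by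
    intro p
    simp [φ, e]
  have hint : Integrable (fun p => f (φ p)) :=
    (hφ.integrable_comp_emb φ.measurableEmbedding).2 hf
  rw [← hφ.integral_comp' f, Measure.volume_eq_prod, integral_prod _ hint]
  simp only [happ]

theorem measureReal_closedBall_zero_one_eq_ballVol :
    (volume : Measure E).real (Metric.closedBall 0 1) = ballVol (Module.finrank ℝ E) := by
  have hb : 0 < ballVol (Module.finrank ℝ E) := by
    have : 0 < Real.Gamma (((Module.finrank ℝ E : ℕ) + 2 : ℝ) / 2) :=
      Real.Gamma_pos_of_pos (by positivity)
    unfold ballVol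
    positivity
  rcases subsingleton_or_nontrivial E with h | h
  · have h0 : Module.finrank ℝ E = 0 := Module.finrank_zero_of_subsingleton
    have hpar := (stdOrthonormalBasis ℝ E).volume_parallelepiped
    rw [Subsingleton.eq_univ_of_nonempty ⟨_, (mem_parallelepiped_iff _ _).2 ⟨0, by simp, rfl⟩⟩]
      at hpar
    rw [Subsingleton.eq_univ_of_nonempty (s := Metric.closedBall (0 : E) 1) ⟨0, by simp⟩,
      measureReal_def, hpar, h0]
    simp [ballVol]
  · rw [measureReal_def, InnerProductSpace.volume_closedBall]
    have he : √Real.pi ^ Module.finrank ℝ E / Real.Gamma ((Module.finrank ℝ E : ℝ) / 2 + 1) =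
        ballVol (Module.finrank ℝ E) := by
      rw [ballVol, Real.sqrt_eq_rpow, ← Real.rpow_natCast, ← Real.rpow_mul Real.pi_pos.le]
      ring_nf
    rw [he]
    simp [hb.le]

end SlicingByHyperplanes

section RadonTransform

open scoped Pointwise

variable {d : ℕ}

theorem finrank_orthogonal_span_unit {ξ : Esp d} (hξ : ‖ξ‖ = 1) :
    Module.finrank ℝ ((ℝ ∙ ξ)ᗮ : Submodule ℝ (Esp d)) = d - 1 := by
  have hne : ξ ≠ 0 := by
    rintro rfl
    simp at hξ
  have h := (ℝ ∙ ξ).finrank_add_finrank_orthogonal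
  rw [finrank_span_singleton hne, finrank_euclideanSpace_fin] at h
  omega

theorem one_sub_sq_rpow_eq_sqrt_pow (hd : 1 ≤ d) {t : ℝ} (ht : t ∈ Set.Icc (-1 : ℝ) 1) :
    (1 - t ^ 2) ^ (((d : ℝ) - 1) / 2) = √(1 - t ^ 2) ^ (d - 1) := by
  have h0 : 0 ≤ 1 - t ^ 2 := by nlinarith [ht.1, ht.2]
  rw [Real.sqrt_eq_rpow, ← Real.rpow_mul_natCast h0, Nat.cast_sub hd, Nat.cast_one]
  ring_nf

/-- The slice of the unit ball at height `t` is a ball of radius `√(1 - t²)`; rescale it. -/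
theorem radon_eq_pow_mul_integral (f : Esp d → ℝ) {ξ : Esp d} (hξ : ‖ξ‖ = 1) {t : ℝ}
    (ht : t ∈ Set.Icc (-1 : ℝ) 1) :
    radon f ξ t = √(1 - t ^ 2) ^ (d - 1) *
      ∫ z in Metric.closedBall (0 : ((ℝ ∙ ξ)ᗮ : Submodule ℝ (Esp d))) 1,
        f (t • ξ + √(1 - t ^ 2) • (z : Esp d)) := by
  have h0 : 0 ≤ 1 - t ^ 2 := by nlinarith [ht.1, ht.2]
  have hset : {y : ((ℝ ∙ ξ)ᗮ : Submodule ℝ (Esp d)) |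
      t • ξ + (y : Esp d) ∈ Metric.closedBall (0 : Esp d) 1} =
      Metric.closedBall 0 (√(1 - t ^ 2)) := by
    ext y
    have hy := norm_smul_add_orthogonal_sq hξ t y
    rw [Set.mem_ofPred_eq, mem_closedBall_zero_iff, mem_closedBall_zero_iff,
      Real.le_sqrt (norm_nonneg _) h0, ← sq_le_one_iff₀ (norm_nonneg _), hy]
    constructor <;> intro h <;> linarith
  have hfin := finrank_orthogonal_span_unit hξ
  rw [radon, hset]
  rcases (Real.sqrt_nonneg (1 - t ^ 2)).eq_or_lt with hs | hs
  · rw [← hs, Metric.closedBall_zero]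
    rcases subsingleton_or_nontrivial ((ℝ ∙ ξ)ᗮ : Submodule ℝ (Esp d)) with h | h
    · rw [← hfin, Module.finrank_zero_of_subsingleton, pow_zero, one_mul,
        Subsingleton.eq_univ_of_nonempty
          (s := Metric.closedBall (0 : ((ℝ ∙ ξ)ᗮ : Submodule ℝ (Esp d))) 1) (by simp),
        Subsingleton.eq_univ_of_nonempty
          (s := ({0} : Set ((ℝ ∙ ξ)ᗮ : Submodule ℝ (Esp d)))) (by simp)]
      congr 1
      ext y
      simp [Subsingleton.elim y 0]
    · have hpos : d - 1 ≠ 0 := hfin ▸ (Module.finrank_pos (R := ℝ)).ne'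
      rw [zero_pow hpos, zero_mul, setIntegral_measure_zero _ (measure_singleton _)]
  · have hscale := Measure.setIntegral_comp_smul
      (volume : Measure ((ℝ ∙ ξ)ᗮ : Submodule ℝ (Esp d)))
      (fun y => f (t • ξ + (y : Esp d))) (Metric.closedBall 0 1) hs.ne'
    rw [smul_closedBall _ _ zero_le_one, smul_zero, Real.norm_of_nonneg hs.le, mul_one, hfin,
      abs_of_pos (by positivity), smul_eq_mul] at hscale
    simp only [Submodule.coe_smul] at hscale
    rw [hscale, mul_inv_cancel_left₀ (by positivity)]

/-- The averages of a polynomial over the slices of the unit ball are polynomial in the height. -/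
theorem exists_polynomial_radon {n : ℕ} {P : Esp d → ℝ} (hP : IsPolyDeg d n P) (hd : 1 ≤ d)
    {ξ : Esp d} (hξ : ‖ξ‖ = 1) :
    ∃ g : Polynomial ℝ, g.natDegree ≤ n ∧ g.eval 1 = ballVol (d - 1) * P ξ ∧
      ∀ t ∈ Set.Icc (-1 : ℝ) 1,
        radon P ξ t = (1 - t ^ 2) ^ (((d : ℝ) - 1) / 2) * g.eval t := by
  obtain ⟨p, hp, hPp⟩ := hP
  obtain ⟨A, B, hA, -, hAB⟩ := isEvenOddSplit_eval hp (fun i => ξ i)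
  let Z := ((ℝ ∙ ξ)ᗮ : Submodule ℝ (Esp d))
  let S : Set Z := Metric.closedBall 0 1
  let J : MvPolynomial (Fin d) ℝ → ℝ := fun q =>
    ∫ z in S, MvPolynomial.eval (fun i => (z : Esp d) i) q
  have hcont : ∀ q : MvPolynomial (Fin d) ℝ,
      Continuous fun z : Z => MvPolynomial.eval (fun i => (z : Esp d) i) q := fun q =>
    (MvPolynomial.continuous_eval q).comp (by fun_prop)
  have hJ : ∀ (Q : Polynomial (MvPolynomial (Fin d) ℝ)) (t : ℝ),
      IntegrableOn (fun z : Z => Q.eval₂ (MvPolynomial.eval fun i => (z : Esp d) i) t) S ∧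
      ∫ z in S, Q.eval₂ (MvPolynomial.eval fun i => (z : Esp d) i) t =
        ∑ k ∈ Finset.range (Q.natDegree + 1), J (Q.coeff k) * t ^ k := by
    intro Q t
    have hi : ∀ k, IntegrableOn
        (fun z : Z => MvPolynomial.eval (fun i => (z : Esp d) i) (Q.coeff k) * t ^ k) S := fun k =>
      ((hcont _).mul continuous_const).continuousOn.integrableOn_compact
        (isCompact_closedBall _ _)
    simp only [Polynomial.eval₂_eq_sum_range]
    refine ⟨integrable_finsetSum _ fun k _ => hi k, ?_⟩
    rw [integral_finsetSum _ fun k _ => hi k]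
    exact Finset.sum_congr rfl fun k _ => integral_mul_const _ _
  have hslice : ∀ t s : ℝ, t ^ 2 + s ^ 2 = 1 → ∫ z in S, P (t • ξ + s • (z : Esp d)) =
      ∑ k ∈ Finset.range (A.natDegree + 1), J (A.coeff k) * t ^ k := by
    have hsplit : ∀ t s : ℝ, t ^ 2 + s ^ 2 = 1 → ∫ z in S, P (t • ξ + s • (z : Esp d)) =
        (∑ k ∈ Finset.range (A.natDegree + 1), J (A.coeff k) * t ^ k) +
          s * ∑ k ∈ Finset.range (B.natDegree + 1), J (B.coeff k) * t ^ k := by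
      intro t s hts
      rw [← (hJ A t).2, ← (hJ B t).2, ← integral_const_mul,
        ← integral_add (hJ A t).1 ((hJ B t).1.const_mul s)]
      congr 1
      ext z
      rw [hPp, ← hAB t s _ hts]
      simp
    intro t s hts
    have hneg := Measure.setIntegral_comp_smul (volume : Measure Z)
      (fun z => P (t • ξ + s • (z : Esp d))) S (R := -1) (by norm_num)
    have hS : (-1 : ℝ) • S = S := by
      simp only [S]
      rw [smul_closedBall _ _ zero_le_one]
      simp
    rw [hS, abs_inv, abs_pow, abs_neg, abs_one, one_pow, inv_one, one_smul] at hneg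
    have heq : ∀ z : Z, t • ξ + s • (((-1 : ℝ) • z : Z) : Esp d) = t • ξ + (-s) • (z : Esp d) := by
      intro z
      simp
    simp only [heq] at hneg
    have h1 := hsplit t s hts
    have h2 := hsplit t (-s) (by rw [neg_sq, hts])
    linarith
  let g : Polynomial ℝ := ∑ k ∈ Finset.range (A.natDegree + 1),
    Polynomial.C (J (A.coeff k)) * Polynomial.X ^ k
  have hg : ∀ t, g.eval t = ∑ k ∈ Finset.range (A.natDegree + 1), J (A.coeff k) * t ^ k := by
    intro t
    simp [g, Polynomial.eval_finsetSum]
  refine ⟨g, ?_, ?_, fun t ht => ?_⟩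
  · have hAn : A.natDegree ≤ n :=
      Polynomial.natDegree_le_iff_coeff_eq_zero.2 fun k hk =>
        (Polynomial.degree_lt_iff_coeff_zero _ _).1 hA k hk
    refine Polynomial.natDegree_sum_le_of_forall_le _ _ fun k hk => ?_
    exact (Polynomial.natDegree_C_mul_X_pow_le _ _).trans
      ((Finset.mem_range_succ_iff.1 hk).trans hAn)
  · rw [hg, ← hslice 1 0 (by norm_num)]
    have hvol := measureReal_closedBall_zero_one_eq_ballVol (E := Z)
    rw [finrank_orthogonal_span_unit hξ] at hvol
    simp [S, hvol]
  · have h0 : 0 ≤ 1 - t ^ 2 := by nlinarith [ht.1, ht.2]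
    rw [hg, radon_eq_pow_mul_integral P hξ ht, one_sub_sq_rpow_eq_sqrt_pow hd ht,
      ← hslice t (√(1 - t ^ 2)) (by rw [Real.sq_sqrt h0]; ring)]

/-- A univariate polynomial in `⟨ξ, x⟩` is a polynomial in `x` of at most the same degree. -/
theorem exists_mvPolynomial_eval_inner (ξ : Esp d) (q : Polynomial ℝ) :
    ∃ Q : MvPolynomial (Fin d) ℝ, Q.totalDegree ≤ q.natDegree ∧
      ∀ x : Esp d, MvPolynomial.eval (fun i => x i) Q = q.eval (inner ℝ ξ x) := by
  let L : MvPolynomial (Fin d) ℝ := ∑ i, MvPolynomial.C (ξ i) * MvPolynomial.X i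
  have hL : L.totalDegree ≤ 1 := by
    refine MvPolynomial.totalDegree_finsetSum_le fun i _ => ?_
    refine (MvPolynomial.totalDegree_mul _ _).trans ?_
    simp
  refine ⟨∑ k ∈ Finset.range (q.natDegree + 1), MvPolynomial.C (q.coeff k) * L ^ k, ?_, ?_⟩
  · refine MvPolynomial.totalDegree_finsetSum_le fun k hk => ?_
    refine (MvPolynomial.totalDegree_mul _ _).trans ?_
    rw [MvPolynomial.totalDegree_C, zero_add]
    refine (MvPolynomial.totalDegree_pow _ _).trans ?_
    have := Finset.mem_range_succ_iff.1 hk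
    nlinarith
  · intro x
    have hLx : MvPolynomial.eval (fun i => x i) L = inner ℝ ξ x := by
      simp [L, PiLp.inner_apply, mul_comm]
    simp [Polynomial.eval_eq_sum_range, hLx]

/-- Integrating a function against a ridge function over the ball, slice by slice. -/
theorem integral_closedBall_mul_ridge {f : Esp d → ℝ} (hf : Continuous f) {ξ : Esp d}
    (hξ : ‖ξ‖ = 1) {q : ℝ → ℝ} (hq : Continuous q) :
    ∫ x in Metric.closedBall (0 : Esp d) 1, f x * q (inner ℝ ξ x) =
      ∫ t in (-1 : ℝ)..1, radon f ξ t * q t := by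
  have hint : IntegrableOn (fun x : Esp d => f x * q (inner ℝ ξ x)) (Metric.closedBall 0 1) :=
    (by fun_prop : Continuous fun x : Esp d =>
      f x * q (inner ℝ ξ x)).continuousOn.integrableOn_compact (isCompact_closedBall _ _)
  rw [← integral_indicator Metric.isClosed_closedBall.measurableSet,
    integral_eq_integral_integral_orthogonal hξ
      (hint.integrable_indicator Metric.isClosed_closedBall.measurableSet),
    intervalIntegral.integral_of_le (by norm_num), ← integral_Icc_eq_integral_Ioc,
    ← integral_indicator measurableSet_Icc]
  congr 1
  ext t
  have hslice : ∫ y : ((ℝ ∙ ξ)ᗮ : Submodule ℝ (Esp d)),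
      (Metric.closedBall (0 : Esp d) 1).indicator (fun x => f x * q (inner ℝ ξ x))
        (t • ξ + (y : Esp d)) = radon f ξ t * q t := by
    rw [radon, ← integral_mul_const, ← integral_indicator]
    · congr 1
      ext y
      simp only [Set.indicator, inner_smul_add_orthogonal hξ]
      rfl
    · exact (Metric.isClosed_closedBall.preimage (by fun_prop :
        Continuous fun y : ((ℝ ∙ ξ)ᗮ : Submodule ℝ (Esp d)) => t • ξ + (y : Esp d))).measurableSet
  rw [hslice]
  by_cases ht : t ∈ Set.Icc (-1 : ℝ) 1
  · rw [Set.indicator_of_mem ht]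
  · have hempty : {y : ((ℝ ∙ ξ)ᗮ : Submodule ℝ (Esp d)) |
        t • ξ + (y : Esp d) ∈ Metric.closedBall (0 : Esp d) 1} = ∅ := by
      ext y
      simp only [Set.mem_ofPred_eq, mem_closedBall_zero_iff, Set.mem_empty_iff_false, iff_false]
      intro hy
      rw [← sq_le_one_iff₀ (norm_nonneg _), norm_smul_add_orthogonal_sq hξ] at hy
      exact ht (abs_le.1 ((sq_le_one_iff_abs_le_one t).1 (by nlinarith [sq_nonneg ‖y‖])))
    rw [Set.indicator_of_notMem ht, radon, hempty, setIntegral_empty, zero_mul]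

end RadonTransform

/-- For `P ∈ V_n^d` (orthogonal with respect to the Lebesgue measure on
`B^d`), every `t ∈ [-1,1]` and `ξ ∈ S^{d-1}`:
`R P(ξ,t) = b_{d-1} (1-t²)^{(d-1)/2} (C_n^{d/2}(t)/C_n^{d/2}(1)) P(ξ)`.
In particular this holds when `P` is a spherical harmonic of degree `n`. -/
theorem radon_of_orthogonal_polynomial (d n : ℕ) (hd : 1 ≤ d)
    (P : Esp d → ℝ) (hP : MemV d n P)
    (ξ : Esp d) (hξ : ‖ξ‖ = 1) (t : ℝ) (ht : t ∈ Set.Icc (-1 : ℝ) 1) :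
    radon P ξ t = ballVol (d - 1) * (1 - t ^ 2) ^ (((d : ℝ) - 1) / 2) *
      (gegen ((d : ℝ) / 2) n t / gegen ((d : ℝ) / 2) n 1) * P ξ := by
  obtain ⟨g, hgn, hg1, hg⟩ := exists_polynomial_radon hP.1 hd hξ
  have hcont : Continuous P := by
    obtain ⟨p, -, hp⟩ := hP.1
    rw [funext hp]
    exact (MvPolynomial.continuous_eval p).comp (by fun_prop)
  have hlam : (1 : ℝ) / 2 ≤ (d : ℝ) / 2 := by
    have : (1 : ℝ) ≤ d := by exact_mod_cast hd
    linarith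
  have key := eval_eq_gegen_div_mul_of_orthogonal hlam hgn (fun q hq => ?_) t
  · rw [hg t ht, key, hg1]
    ring
  · rcases eq_or_ne q 0 with rfl | hq0
    · simp
    obtain ⟨Q, hQ, hQq⟩ := exists_mvPolynomial_eval_inner ξ q
    have horth := hP.2 (fun x => q.eval (inner ℝ ξ x))
      ⟨Q, hQ.trans_lt ((Polynomial.natDegree_lt_iff_degree_lt hq0).2 hq), fun x => (hQq x).symm⟩
    rw [integral_closedBall_mul_ridge hcont hξ q.continuous] at horth
    rw [← horth]
    refine intervalIntegral.integral_congr fun t ht => ?_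
    rw [Set.uIcc_of_le (by norm_num)] at ht
    simp only [hg t ht]
    ring_nf
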